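/- Let p ∈ [1,∞), let q_1, …, q_n ∈ [1,∞] with conjugate exponents q_j*, and let λ > 0. Consider the column-wise uncertainty model: U is the set of linear maps Δ on ℝ^{m×n} of the form Δ(X) = [Δ^{(1)}X_1, …, Δ^{(n)}X_n], where X_j is the j-th column of X and each Δ^{(j)} ∈ ℝ^{m×m} has entrywise ℓ_{q_j} norm ‖Δ^{(j)}‖_{F_{q_j}} ≤ λ. Then for every X ∈ ℝ^{m×n}, sup_{Δ ∈ U} ‖Δ(X)‖_{F_p} = λ·(Σ_{j=1}^n δ_m(p,q_j)^p · ‖X_j‖_{q_j*}^p)^{1/p}, where ‖·‖_{F_p} is the entrywise ℓ_p norm on matrices. -/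

import Mathlib

open scoped ENNReal

noncomputable def lpNorm (p : ℝ≥0∞) {ι : Type*} [Fintype ι] (x : ι → ℝ) : ℝ :=
  ‖(WithLp.equiv p (ι → ℝ)).symm x‖

noncomputable def frobNorm (p : ℝ≥0∞) {m n : ℕ} (A : Matrix (Fin m) (Fin n) ℝ) : ℝ :=
  lpNorm p (fun ij : Fin m × Fin n => A ij.1 ij.2)

noncomputable def discrep (m : ℕ) (a b : ℝ≥0∞) : ℝ :=
  sSup {t : ℝ | ∃ u : Fin m → ℝ, lpNorm b u = 1 ∧ t = lpNorm a u}

section LpNorm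

variable {ι κ : Type*} [Fintype ι] [Fintype κ] {p q : ℝ≥0∞}

lemma lpNorm_eq_sum (hp : 0 < p.toReal) (x : ι → ℝ) :
    lpNorm p x = (∑ i, |x i| ^ p.toReal) ^ (1 / p.toReal) := by
  simp [lpNorm, PiLp.norm_eq_sum hp]

lemma lpNorm_one_eq_sum (x : ι → ℝ) : lpNorm 1 x = ∑ i, |x i| := by
  simp [lpNorm_eq_sum (p := 1) (by simp)]

lemma lpNorm_top_eq_norm (x : ι → ℝ) : lpNorm ⊤ x = ‖x‖ :=
  PiLp.norm_toLp x

lemma toReal_pos_of_one_le (hp : 1 ≤ p) (hp' : p ≠ ⊤) : 0 < p.toReal :=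
  ENNReal.toReal_pos (zero_lt_one.trans_le hp).ne' hp'

lemma lpNorm_nonneg (hp : 1 ≤ p) (x : ι → ℝ) : 0 ≤ lpNorm p x := by
  have : Fact (1 ≤ p) := ⟨hp⟩
  exact norm_nonneg (WithLp.toLp p x)

lemma lpNorm_smul (hp : 1 ≤ p) (c : ℝ) (x : ι → ℝ) : lpNorm p (c • x) = |c| * lpNorm p x := by
  have : Fact (1 ≤ p) := ⟨hp⟩
  exact norm_smul c (WithLp.toLp p x)

lemma lpNorm_eq_zero (hp : 1 ≤ p) {x : ι → ℝ} : lpNorm p x = 0 ↔ x = 0 := by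
  have : Fact (1 ≤ p) := ⟨hp⟩
  exact norm_eq_zero.trans (WithLp.toLp_eq_zero p)

lemma lpNorm_rpow (hp : 0 < p.toReal) (x : ι → ℝ) :
    lpNorm p x ^ p.toReal = ∑ i, |x i| ^ p.toReal := by
  rw [lpNorm_eq_sum hp, one_div,
    Real.rpow_inv_rpow (Finset.sum_nonneg fun i _ => by positivity) hp.ne']

lemma lpNorm_mono (hp : 1 ≤ p) {x y : ι → ℝ} (h : ∀ i, |x i| ≤ |y i|) :
    lpNorm p x ≤ lpNorm p y := by
  rcases eq_or_ne p ⊤ with rfl | hp'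
  · simp only [lpNorm_top_eq_norm]
    exact (pi_norm_le_iff_of_nonneg (norm_nonneg y)).2 fun i => (h i).trans (norm_le_pi_norm y i)
  · have hpos := toReal_pos_of_one_le hp hp'
    simp only [lpNorm_eq_sum hpos]
    refine Real.rpow_le_rpow (by positivity) (Finset.sum_le_sum fun i _ => ?_) (by positivity)
    exact Real.rpow_le_rpow (abs_nonneg _) (h i) hpos.le

lemma lpNorm_prod (hp : 1 ≤ p) (A : ι → κ → ℝ) :
    lpNorm p (fun ij : ι × κ => A ij.1 ij.2) = lpNorm p (fun i => lpNorm p (A i)) := by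
  rcases eq_or_ne p ⊤ with rfl | hp'
  · simp only [lpNorm_top_eq_norm]
    apply le_antisymm
    · refine (pi_norm_le_iff_of_nonneg (norm_nonneg _)).2 fun ij => ?_
      refine (norm_le_pi_norm (A ij.1) ij.2).trans ?_
      simpa using norm_le_pi_norm (fun i => ‖A i‖) ij.1
    · refine (pi_norm_le_iff_of_nonneg (norm_nonneg _)).2 fun i => ?_
      rw [norm_norm]
      exact (pi_norm_le_iff_of_nonneg (norm_nonneg _)).2 fun j =>
        norm_le_pi_norm (fun ij : ι × κ => A ij.1 ij.2) (i, j)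
  · have hpos := toReal_pos_of_one_le hp hp'
    rw [lpNorm_eq_sum hpos, lpNorm_eq_sum hpos, Fintype.sum_prod_type]
    simp only [abs_of_nonneg (lpNorm_nonneg hp _), lpNorm_rpow hpos]

/-- Hölder's inequality for finite sums, including the endpoint exponents. -/
lemma abs_sum_mul_le_lpNorm_mul_lpNorm [hpq : p.HolderConjugate q] (x y : ι → ℝ) :
    |∑ i, x i * y i| ≤ lpNorm p x * lpNorm q y := by
  have one_top (x y : ι → ℝ) : ∑ i, |x i| * |y i| ≤ lpNorm 1 x * lpNorm ⊤ y := by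
    rw [lpNorm_one_eq_sum, lpNorm_top_eq_norm, Finset.sum_mul]
    gcongr with i
    exact norm_le_pi_norm y i
  refine (Finset.abs_sum_le_sum_abs _ _).trans ?_
  simp only [abs_mul]
  rcases eq_or_ne p ⊤ with rfl | hp
  · obtain rfl : q = 1 := ENNReal.HolderConjugate.unique ⊤ q 1
    simpa only [mul_comm] using one_top y x
  rcases eq_or_ne q ⊤ with rfl | hq
  · obtain rfl : p = 1 := ENNReal.HolderConjugate.unique ⊤ p 1
    exact one_top x y
  have h : p.toReal.HolderConjugate q.toReal := ENNReal.HolderConjugate.toReal_of_ne_top hp hq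
  simpa [lpNorm_eq_sum h.pos, lpNorm_eq_sum h.symm.pos] using
    Real.inner_le_Lp_mul_Lq Finset.univ (fun i => |x i|) (fun i => |y i|) h

/-- The `ℓ_q` norm is attained as a pairing with an element of the `ℓ_p` unit ball. -/
lemma exists_lpNorm_le_one_sum_mul_eq [hpq : p.HolderConjugate q] (x : ι → ℝ) :
    ∃ v : ι → ℝ, lpNorm p v ≤ 1 ∧ ∑ i, v i * x i = lpNorm q x := by
  have abs_sign_le (a : ℝ) : |(SignType.sign a : ℝ)| ≤ 1 := by
    rcases lt_trichotomy a 0 with h | h | h <;> simp [h]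
  rcases eq_or_ne p ⊤ with rfl | hp
  · obtain rfl : q = 1 := ENNReal.HolderConjugate.unique ⊤ q 1
    refine ⟨fun i => SignType.sign (x i), ?_, ?_⟩
    · rw [lpNorm_top_eq_norm]
      exact (pi_norm_le_iff_of_nonneg zero_le_one).2 fun i => abs_sign_le _
    · simp [lpNorm_one_eq_sum, sign_mul_self]
  rcases eq_or_ne q ⊤ with rfl | hq
  · obtain rfl : p = 1 := ENNReal.HolderConjugate.unique ⊤ p 1
    classical
    rcases isEmpty_or_nonempty ι with hι | hι
    · exact ⟨0, by simp [lpNorm_one_eq_sum, lpNorm_top_eq_norm, Subsingleton.elim x 0]⟩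
    obtain ⟨k, hk⟩ := Finite.exists_max fun i => |x i|
    have hnorm : lpNorm ⊤ x = |x k| := by
      rw [lpNorm_top_eq_norm]
      exact le_antisymm ((pi_norm_le_iff_of_nonneg (abs_nonneg _)).2 hk) (norm_le_pi_norm x k)
    refine ⟨Pi.single k (SignType.sign (x k) : ℝ), ?_, ?_⟩
    · rw [lpNorm_one_eq_sum, Finset.sum_eq_single k (by simp +contextual) (by simp)]
      simpa using abs_sign_le (x k)
    · rw [hnorm, Finset.sum_eq_single k (by simp +contextual) (by simp)]
      simp [sign_mul_self]
  have h : p.toReal.HolderConjugate q.toReal := ENNReal.HolderConjugate.toReal_of_ne_top hp hq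
  obtain ⟨g, hg, hgx⟩ := (NNReal.isGreatest_Lp Finset.univ (fun i => Real.nnabs (x i)) h.symm).1
  have hg' : ∑ i, (g i : ℝ) ^ p.toReal ≤ 1 := by exact_mod_cast hg
  refine ⟨fun i => SignType.sign (x i) * g i, ?_, ?_⟩
  · rw [lpNorm_eq_sum h.pos]
    refine Real.rpow_le_one (by positivity) (le_trans ?_ hg') (by have := h.pos; positivity)
    refine Finset.sum_le_sum fun i _ => Real.rpow_le_rpow (abs_nonneg _) ?_ h.nonneg
    rw [abs_mul, NNReal.abs_eq]
    exact mul_le_of_le_one_left (g i).2 (abs_sign_le _)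
  · have := congrArg NNReal.toReal hgx
    push_cast at this
    rw [lpNorm_eq_sum h.symm.pos]
    simpa [mul_right_comm _ _ (x _), sign_mul_self] using this

lemma exists_lpNorm_bound (hp : 1 ≤ p) (hq : 1 ≤ q) (m : ℕ) :
    ∃ u : Fin m → ℝ, lpNorm q u ≤ 1 ∧ lpNorm p u = discrep m p q ∧
      ∀ w : Fin m → ℝ, lpNorm p w ≤ discrep m p q * lpNorm q w := by
  have : Fact (1 ≤ p) := ⟨hp⟩
  have : Fact (1 ≤ q) := ⟨hq⟩
  have lpNorm_zero {r : ℝ≥0∞} (hr : 1 ≤ r) : lpNorm r (0 : Fin m → ℝ) = 0 :=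
    (lpNorm_eq_zero hr).2 rfl
  rcases isEmpty_or_nonempty (Fin m) with hm | hm
  · have h0 (w : Fin m → ℝ) : w = 0 := Subsingleton.elim _ _
    refine ⟨0, by simp [lpNorm_zero hq], ?_, fun w => by simp [h0 w, lpNorm_zero hp, lpNorm_zero hq]⟩
    have hempty : {t : ℝ | ∃ u : Fin m → ℝ, lpNorm q u = 1 ∧ t = lpNorm p u} = ∅ := by
      ext t
      simp [h0, lpNorm_zero hq]
    rw [discrep, hempty, Real.sSup_empty, lpNorm_zero hp]
  have hcont : Continuous fun w : PiLp q (fun _ : Fin m => ℝ) => lpNorm p (WithLp.ofLp w) :=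
    continuous_norm.comp ((PiLp.continuous_toLp p _).comp (PiLp.continuous_ofLp q _))
  obtain ⟨u, hu, hmax⟩ := (isCompact_sphere (0 : PiLp q (fun _ : Fin m => ℝ)) 1).exists_isMaxOn
    (NormedSpace.sphere_nonempty.2 zero_le_one) hcont.continuousOn
  have hu1 : lpNorm q (WithLp.ofLp u) = 1 := mem_sphere_zero_iff_norm.1 hu
  have hle (w : Fin m → ℝ) (hw : lpNorm q w = 1) : lpNorm p w ≤ lpNorm p (WithLp.ofLp u) :=
    hmax (a := WithLp.toLp q w) (mem_sphere_zero_iff_norm.2 hw)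
  have hdiscrep : lpNorm p (WithLp.ofLp u) = discrep m p q := by
    symm
    apply IsGreatest.csSup_eq
    refine ⟨⟨_, hu1, rfl⟩, ?_⟩
    rintro _ ⟨w, hw, rfl⟩
    exact hle w hw
  refine ⟨WithLp.ofLp u, hu1.le, hdiscrep, fun w => ?_⟩
  rw [← hdiscrep]
  rcases eq_or_ne w 0 with rfl | hw
  · simp [lpNorm_zero hp, lpNorm_zero hq]
  have hpos : 0 < lpNorm q w := (lpNorm_nonneg hq w).lt_of_ne' ((lpNorm_eq_zero hq).not.2 hw)
  have hscaled := hle ((lpNorm q w)⁻¹ • w) (by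
    rw [lpNorm_smul hq, abs_of_pos (inv_pos.2 hpos), inv_mul_cancel₀ hpos.ne'])
  rwa [lpNorm_smul hp, abs_of_pos (inv_pos.2 hpos), inv_mul_le_iff₀ hpos, mul_comm] at hscaled

end LpNorm

lemma discrep_nonneg {p q : ℝ≥0∞} (hp : 1 ≤ p) (m : ℕ) : 0 ≤ discrep m p q := by
  apply Real.sSup_nonneg
  rintro _ ⟨u, -, rfl⟩
  exact lpNorm_nonneg hp u

lemma lpNorm_mulVec_le {m n : ℕ} {q q' : ℝ≥0∞} (hq : 1 ≤ q) [q.HolderConjugate q']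
    (A : Matrix (Fin m) (Fin n) ℝ) (x : Fin n → ℝ) :
    lpNorm q (A.mulVec x) ≤ frobNorm q A * lpNorm q' x := by
  have hrow : lpNorm q (A.mulVec x) ≤ lpNorm q (lpNorm q' x • fun i => lpNorm q (A i)) := by
    refine lpNorm_mono hq fun i => (abs_sum_mul_le_lpNorm_mul_lpNorm (p := q) (q := q') (A i) x).trans ?_
    rw [Pi.smul_apply, smul_eq_mul, mul_comm]
    exact le_abs_self _
  rwa [lpNorm_smul hq, ← lpNorm_prod hq A, mul_comm, abs_of_nonneg] at hrow
  exact lpNorm_nonneg (ENNReal.HolderConjugate.one_le q' q) x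

lemma frobNorm_vecMulVec {m n : ℕ} {q : ℝ≥0∞} (hq : 1 ≤ q) (u : Fin m → ℝ) (v : Fin n → ℝ) :
    frobNorm q (Matrix.vecMulVec u v) = lpNorm q u * lpNorm q v := by
  have hrow (i : Fin m) : lpNorm q (Matrix.vecMulVec u v i) = |u i| * lpNorm q v :=
    lpNorm_smul hq (u i) v
  have habs : lpNorm q (fun i => |u i|) = lpNorm q u :=
    le_antisymm (lpNorm_mono hq (by simp)) (lpNorm_mono hq (by simp))
  rw [show frobNorm q (Matrix.vecMulVec u v) = _ from lpNorm_prod hq (Matrix.vecMulVec u v)]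
  simp only [hrow, mul_comm _ (lpNorm q v)]
  exact (lpNorm_smul hq _ _).trans (by rw [habs, abs_of_nonneg (lpNorm_nonneg hq v)])

lemma frobNorm_eq_sum_columns {m n : ℕ} {p : ℝ≥0∞} (hp : 0 < p.toReal)
    (A : Matrix (Fin m) (Fin n) ℝ) :
    frobNorm p A = (∑ j, lpNorm p (fun i => A i j) ^ p.toReal) ^ (1 / p.toReal) := by
  rw [frobNorm, lpNorm_eq_sum hp, Fintype.sum_prod_type_right]
  simp only [lpNorm_rpow hp]

/-- The operator norm from the `q`-Frobenius ball of radius `r` at `x`, with its maximizer. -/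
lemma isGreatest_lpNorm_mulVec {m : ℕ} {p q q' : ℝ≥0∞} (hp : 1 ≤ p) (hq : 1 ≤ q)
    [q.HolderConjugate q'] {r : ℝ} (hr : 0 ≤ r) (x : Fin m → ℝ) :
    IsGreatest ((fun A : Matrix (Fin m) (Fin m) ℝ => lpNorm p (A.mulVec x)) ''
      {A | frobNorm q A ≤ r}) (r * (discrep m p q * lpNorm q' x)) := by
  have hx := lpNorm_nonneg (ENNReal.HolderConjugate.one_le q' q) x
  obtain ⟨u, hu, hup, hbound⟩ := exists_lpNorm_bound hp hq m
  constructor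
  · obtain ⟨v, hv, hvx⟩ := exists_lpNorm_le_one_sum_mul_eq (p := q) (q := q') x
    refine ⟨Matrix.vecMulVec (r • u) v, ?_, ?_⟩
    · rw [Set.mem_ofPred_eq, frobNorm_vecMulVec hq, lpNorm_smul hq, abs_of_nonneg hr, mul_assoc]
      exact mul_le_of_le_one_right hr (mul_le_one₀ hu (lpNorm_nonneg hq v) hv)
    · have hmul : (Matrix.vecMulVec (r • u) v).mulVec x = (r * lpNorm q' x) • u := by
        ext i
        simp only [Matrix.mulVec, dotProduct, Matrix.vecMulVec_apply, Pi.smul_apply, smul_eq_mul,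
          mul_assoc, ← Finset.mul_sum, hvx]
        ring
      simp only [hmul, lpNorm_smul hp, hup, abs_of_nonneg (mul_nonneg hr hx)]
      ring
  · rintro _ ⟨A, hA, rfl⟩
    calc lpNorm p (A.mulVec x) ≤ discrep m p q * lpNorm q (A.mulVec x) := hbound _
      _ ≤ discrep m p q * (r * lpNorm q' x) := by
        refine mul_le_mul_of_nonneg_left ((lpNorm_mulVec_le (q' := q') hq A x).trans ?_) (discrep_nonneg hp m)
        exact mul_le_mul_of_nonneg_right hA hx
      _ = r * (discrep m p q * lpNorm q' x) := by ring

/-- The worst-case penalty for the column-wise uncertainty model with per-column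
q_j-Frobenius balls, under the entrywise ℓ_p matrix loss (p ∈ [1,∞)). -/
theorem stmt19 {m n : ℕ} (p : ℝ≥0∞) (hp1 : 1 ≤ p) (hp2 : p ≠ ⊤)
    (q qs : Fin n → ℝ≥0∞) (hq : ∀ j, 1 ≤ q j) (hqs : ∀ j, 1 / q j + 1 / qs j = 1)
    (lam : ℝ) (hlam : 0 < lam) (X : Matrix (Fin m) (Fin n) ℝ) :
    sSup {t : ℝ | ∃ D : Fin n → Matrix (Fin m) (Fin m) ℝ,
        (∀ j, frobNorm (q j) (D j) ≤ lam) ∧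
        t = frobNorm p (Matrix.of fun i j => (D j).mulVec (fun k => X k j) i)} =
      lam * (∑ j, discrep m p (q j) ^ p.toReal *
          lpNorm (qs j) (fun k => X k j) ^ p.toReal) ^ (1 / p.toReal) := by
  have hpos := toReal_pos_of_one_le hp1 hp2
  have hconj (j : Fin n) : (q j).HolderConjugate (qs j) :=
    ENNReal.holderConjugate_iff.2 (by simpa using hqs j)
  have hgreatest (j : Fin n) := isGreatest_lpNorm_mulVec (q' := qs j) hp1 (hq j) hlam.le
    (fun k => X k j)
  have hδ (j : Fin n) : 0 ≤ discrep m p (q j) := discrep_nonneg hp1 m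
  have hX (j : Fin n) : 0 ≤ lpNorm (qs j) (fun k => X k j) :=
    lpNorm_nonneg (ENNReal.HolderConjugate.one_le (qs j) (q j)) _
  have hvalue : lam * (∑ j, discrep m p (q j) ^ p.toReal *
        lpNorm (qs j) (fun k => X k j) ^ p.toReal) ^ (1 / p.toReal) =
      (∑ j, (lam * (discrep m p (q j) * lpNorm (qs j) (fun k => X k j))) ^ p.toReal) ^
        (1 / p.toReal) := by
    simp only [Real.mul_rpow hlam.le (mul_nonneg (hδ _) (hX _)), Real.mul_rpow (hδ _) (hX _),
      ← Finset.mul_sum]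
    rw [Real.mul_rpow (by positivity) (Finset.sum_nonneg fun j _ =>
        mul_nonneg (Real.rpow_nonneg (hδ j) _) (Real.rpow_nonneg (hX j) _)),
      one_div, Real.rpow_rpow_inv hlam.le hpos.ne']
  rw [hvalue]
  apply IsGreatest.csSup_eq
  constructor
  · choose D hD hDX using fun j => (hgreatest j).1
    refine ⟨D, hD, ?_⟩
    rw [frobNorm_eq_sum_columns hpos]
    simp only [← hDX, Matrix.of_apply]
  · rintro _ ⟨D, hD, rfl⟩
    rw [frobNorm_eq_sum_columns hpos]
    refine Real.rpow_le_rpow (Finset.sum_nonneg fun j _ =>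
      Real.rpow_nonneg (lpNorm_nonneg hp1 _) _) ?_ (by positivity)
    exact Finset.sum_le_sum fun j _ => Real.rpow_le_rpow (lpNorm_nonneg hp1 _)
      ((hgreatest j).2 ⟨D j, hD j, rfl⟩) hpos.le
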